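/- arXiv:1203.0765 — 6 statements merged into one kernel-verified Lean document; each statement's English description precedes it below -/
import Mathlib

section
/- Let A be a multiplicity-free G-algebra having no invariant left ideals and no invariant right ideals other than 0 and A. Then for all simple G-submodules X, Y, Z of A, the union ⋃_{U ∈ X∘Y} (U∘Z) equals the set of simple G-submodules of A contained in X·Y·Z, and the union ⋃_{T ∈ Y∘Z} (X∘T) equals this same set; in particular the hyperoperation ∘ on simple G-submodules of A is associative. -/
/-!
Common setup: `G` is a group acting on the unital `k`-algebra `A` by `k`-algebra
automorphisms, expressed via `[MulSemiringAction G A]` (additive and multiplicative,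
with `g • 1 = 1`) together with `[SMulCommClass G k A]` (`k`-linearity).
Submodule products `E * F` are spanned by products, and `1 : Submodule k A = k·1_A`.
-/

/-- A `G`-submodule of `A`: a `G`-invariant `k`-subspace. -/
def IsGSubmodule (G : Type*) {k A : Type*} [Field k] [Ring A] [Algebra k A]
    [Group G] [MulSemiringAction G A] (E : Submodule k A) : Prop :=
  ∀ (g : G), ∀ a ∈ E, g • a ∈ E

/-- A simple `G`-submodule of `A`: a minimal nonzero `G`-submodule. -/
def IsSimpleGSubmodule (G : Type*) {k A : Type*} [Field k] [Ring A] [Algebra k A]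
    [Group G] [MulSemiringAction G A] (X : Submodule k A) : Prop :=
  IsGSubmodule G X ∧ X ≠ ⊥ ∧
    ∀ Y : Submodule k A, IsGSubmodule G Y → Y ≤ X → Y = ⊥ ∨ Y = X

/-- `X` and `Y` are isomorphic as `k[G]`-modules: there is a `G`-equivariant `k`-linear
endomorphism of `A` carrying `X` isomorphically onto `Y`. -/
def GModIso (G : Type*) {k A : Type*} [Field k] [Ring A] [Algebra k A]
    [Group G] [MulSemiringAction G A] (X Y : Submodule k A) : Prop :=
  ∃ f : A →ₗ[k] A, (∀ (g : G) (a : A), f (g • a) = g • f a) ∧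
    Submodule.map f X = Y ∧ Disjoint X (LinearMap.ker f)

/-- `A` is semisimple as a `k[G]`-module: it is the sum of its simple `G`-submodules. -/
def GSemisimple (k A G : Type*) [Field k] [Ring A] [Algebra k A]
    [Group G] [MulSemiringAction G A] : Prop :=
  sSup {X : Submodule k A | IsSimpleGSubmodule G X} = ⊤

/-- `A` is a multiplicity-free `G`-algebra: semisimple as a `k[G]`-module and no two
distinct simple `G`-submodules are isomorphic as `k[G]`-modules. -/
def GMultiplicityFree (k A G : Type*) [Field k] [Ring A] [Algebra k A]
    [Group G] [MulSemiringAction G A] : Prop :=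
  GSemisimple k A G ∧ ∀ X Y : Submodule k A, IsSimpleGSubmodule G X →
    IsSimpleGSubmodule G Y → GModIso G X Y → X = Y

/-- `A` has no invariant left ideals other than `0` and `A`. -/
def NoProperInvariantLeftIdeals (k A G : Type*) [Field k] [Ring A] [Algebra k A]
    [Group G] [MulSemiringAction G A] : Prop :=
  ∀ L : Submodule k A, (∀ a : A, ∀ x ∈ L, a * x ∈ L) → IsGSubmodule G L → L = ⊥ ∨ L = ⊤

/-- `A` has no invariant right ideals other than `0` and `A`. -/
def NoProperInvariantRightIdeals (k A G : Type*) [Field k] [Ring A] [Algebra k A]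
    [Group G] [MulSemiringAction G A] : Prop :=
  ∀ L : Submodule k A, (∀ a : A, ∀ x ∈ L, x * a ∈ L) → IsGSubmodule G L → L = ⊥ ∨ L = ⊤

namespace HypAux

section

variable {k A G : Type*} [Field k] [Ring A] [Algebra k A] [Group G]
    [MulSemiringAction G A] [SMulCommClass G k A]

variable (k A G) in
/-- The algebra of operators generated by the action of `G`. -/
abbrev OpAlg : Subalgebra k (Module.End k A) :=
  Algebra.adjoin k (Set.range fun g : G => DistribSMul.toLinearMap k A g)

variable (k A G) in
/-- The same algebra as a bare type. -/
def Op : Type _ := OpAlg k A G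

noncomputable instance : Ring (Op k A G) := (OpAlg k A G).toRing

noncomputable instance : Module (Op k A G) A where
  smul r a := r.1 a
  one_smul _ := rfl
  mul_smul _ _ _ := rfl
  smul_zero r := map_zero r.1
  smul_add r := map_add r.1
  add_smul _ _ _ := rfl
  zero_smul _ := rfl

variable (k A) in
/-- The operator attached to a group element. -/
def op (g : G) : Op k A G :=
  ⟨DistribSMul.toLinearMap k A g, Algebra.subset_adjoin ⟨g, rfl⟩⟩

theorem op_smul (g : G) (a : A) : op k A g • a = g • a := rfl

theorem op_mem {E : Submodule k A} (hE : IsGSubmodule G E) (r : Module.End k A)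
    (hr : r ∈ OpAlg k A G) : ∀ a ∈ E, r a ∈ E := by
  induction hr using Algebra.adjoin_induction with
  | mem x hx =>
    obtain ⟨g, rfl⟩ := hx
    exact fun a ha => hE g a ha
  | algebraMap c => exact fun a ha => E.smul_mem c ha
  | add x y _ _ hx hy => exact fun a ha => E.add_mem (hx a ha) (hy a ha)
  | mul x y _ _ hx hy => exact fun a ha => hx _ (hy a ha)

/-- A `G`-submodule as a submodule over the operator algebra. -/
def toR (E : Submodule k A) (hE : IsGSubmodule G E) : Submodule (Op k A G) A where
  carrier := E
  add_mem' := E.add_mem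
  zero_mem' := E.zero_mem
  smul_mem' r a ha := op_mem hE r.1 r.2 a ha

theorem mem_toR {E : Submodule k A} {hE : IsGSubmodule G E} {a : A} :
    a ∈ toR E hE ↔ a ∈ E := Iff.rfl

/-- Back to `k`-subspaces. -/
def ofR (N : Submodule (Op k A G) A) : Submodule k A where
  carrier := N
  add_mem' := N.add_mem
  zero_mem' := N.zero_mem
  smul_mem' c a ha := N.smul_mem (algebraMap k (OpAlg k A G) c) ha

theorem mem_ofR {N : Submodule (Op k A G) A} {a : A} : a ∈ ofR N ↔ a ∈ N := Iff.rfl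

theorem ofR_inv (N : Submodule (Op k A G) A) : IsGSubmodule G (ofR N) :=
  fun g _ ha => N.smul_mem (op k A g) ha

theorem toR_simple {E : Submodule k A} (hE : IsSimpleGSubmodule G E) :
    IsSimpleModule (Op k A G) (toR E hE.1) := by
  rw [isSimpleModule_iff_isAtom]
  refine ⟨fun h => hE.2.1 ?_, fun N hN => ?_⟩
  · rw [Submodule.eq_bot_iff] at h ⊢
    exact h
  · rcases hE.2.2 (ofR N) (ofR_inv N) (fun a ha => hN.le ha) with h | h
    · rw [Submodule.eq_bot_iff] at h ⊢
      exact h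
    · refine absurd (fun a ha => ?_) hN.not_ge
      have : a ∈ ofR N := by rw [h]; exact ha
      exact this

theorem ofR_simple {N : Submodule (Op k A G) A} (hN : IsSimpleModule (Op k A G) N) :
    IsSimpleGSubmodule G (ofR N) := by
  rw [isSimpleModule_iff_isAtom] at hN
  refine ⟨ofR_inv N, fun h => hN.1 ?_, fun Y hY hle => ?_⟩
  · rw [Submodule.eq_bot_iff] at h ⊢
    exact h
  · rcases hN.le_iff.1 (show toR Y hY ≤ N from hle) with h | h
    · left
      rw [Submodule.eq_bot_iff] at h ⊢
      exact h
    · right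
      ext a
      rw [mem_ofR, ← h, mem_toR]

theorem sSup_inv {S : Set (Submodule k A)} (hS : ∀ E ∈ S, IsGSubmodule G E) :
    IsGSubmodule G (sSup S) := by
  intro g
  have : sSup S ≤ (sSup S).comap (DistribSMul.toLinearMap k A g) :=
    sSup_le fun E hE a ha => (le_sSup hE : E ≤ sSup S) (hS E hE g a ha)
  exact this

theorem mul_inv {E F : Submodule k A} (hE : IsGSubmodule G E) (hF : IsGSubmodule G F) :
    IsGSubmodule G (E * F) := by
  intro g
  have : E * F ≤ (E * F).comap (DistribSMul.toLinearMap k A g) := by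
    rw [Submodule.mul_le]
    intro m hm n hn
    change g • (m * n) ∈ E * F
    rw [smul_mul']
    exact Submodule.mul_mem_mul (hE g m hm) (hF g n hn)
  exact this

theorem semisimple (h : GSemisimple k A G) : IsSemisimpleModule (Op k A G) A := by
  apply IsSemisimpleModule.of_sSup_simples_eq_top
  rw [eq_top_iff]
  have : sSup {X : Submodule k A | IsSimpleGSubmodule G X} ≤
      ofR (sSup {m : Submodule (Op k A G) A | IsSimpleModule (Op k A G) m}) :=
    sSup_le fun E hE a ha =>
      (le_sSup (toR_simple hE) : toR E hE.1 ≤ sSup {m : Submodule (Op k A G) A | IsSimpleModule (Op k A G) m}) ha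
  rw [h] at this
  exact fun a _ => this trivial

theorem eq_sSup (h : GSemisimple k A G) {E : Submodule k A} (hE : IsGSubmodule G E) :
    E ≤ sSup {U | IsSimpleGSubmodule G U ∧ U ≤ E} := by
  have := semisimple h
  have h1 := IsSemisimpleModule.sSup_simples_le (toR E hE)
  have h2 : sSup { m : Submodule (Op k A G) A | IsSimpleModule (Op k A G) m ∧ m ≤ toR E hE } ≤
      toR (sSup {U | IsSimpleGSubmodule G U ∧ U ≤ E}) (sSup_inv fun _ hU => hU.1.1) := by
    refine sSup_le fun m hm a ha => ?_
    have : ofR m ≤ sSup {U | IsSimpleGSubmodule G U ∧ U ≤ E} :=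
      le_sSup ⟨ofR_simple hm.1, fun a ha => hm.2 ha⟩
    exact this ha
  rw [h1] at h2
  exact h2

theorem mem_of_le_sSup (hmf : GMultiplicityFree k A G) {W : Submodule k A}
    (hW : IsSimpleGSubmodule G W) {S : Set (Submodule k A)}
    (hS : ∀ E ∈ S, IsSimpleGSubmodule G E) (hle : W ≤ sSup S) : W ∈ S := by
  have := semisimple hmf.1
  have hWs := toR_simple hW
  let S' : Set (Submodule (Op k A G) A) := {m | ofR m ∈ S}
  have hS' : ∀ m : S', IsSimpleModule (Op k A G) m.1 := fun m => toR_simple (hS _ m.2)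
  have h1 : sSup S ≤ ofR (sSup S') := by
    refine sSup_le fun E hE a ha => ?_
    have : toR E (hS E hE).1 ≤ sSup S' := le_sSup hE
    exact this ha
  obtain ⟨m, hm, ⟨e⟩⟩ := (toR W hW.1).linearEquiv_of_le_sSup S' (fun a ha => h1 (hle ha))
  obtain ⟨Q, hQ⟩ := exists_isCompl (toR W hW.1)
  let f : A →ₗ[Op k A G] A := m.subtype ∘ₗ e.toLinearMap ∘ₗ (toR W hW.1).projectionOnto Q hQ
  have hf : ∀ w : toR W hW.1, f w = e w := by
    intro w
    simp [f, Submodule.projectionOnto_apply_left]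
  have : W = ofR m := by
    refine hmf.2 W (ofR m) hW (hS _ hm) ⟨
      { toFun := f
        map_add' := map_add f
        map_smul' := fun c a => f.map_smul (algebraMap k (OpAlg k A G) c) a },
      fun g a => f.map_smul (op k A g) a, ?_, ?_⟩
    · ext a
      constructor
      · rintro ⟨w, hw, rfl⟩
        change f w ∈ m
        rw [hf ⟨w, hw⟩]
        exact (e ⟨w, hw⟩).2
      · intro ha
        refine ⟨e.symm ⟨a, ha⟩, (e.symm ⟨a, ha⟩).2, ?_⟩
        change f _ = a
        rw [hf]
        simp
    · rw [Submodule.disjoint_def]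
      intro w hw hw0
      change f w = 0 at hw0
      rw [hf ⟨w, hw⟩] at hw0
      have h3 : e ⟨w, hw⟩ = 0 := Subtype.ext hw0
      rw [e.map_eq_zero_iff] at h3
      exact congrArg Subtype.val h3
  rw [this]
  exact hm

theorem key (hmf : GMultiplicityFree k A G) {W : Submodule k A}
    (hW : IsSimpleGSubmodule G W) {ι : Type*} (F : ι → Submodule k A)
    (hF : ∀ i, IsGSubmodule G (F i)) (hle : W ≤ ⨆ i, F i) : ∃ i, W ≤ F i := by
  have : W ∈ {V | IsSimpleGSubmodule G V ∧ ∃ i, V ≤ F i} := by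
    refine mem_of_le_sSup hmf hW (fun _ h => h.1) (hle.trans (iSup_le fun i => ?_))
    exact (eq_sSup hmf.1 (hF i)).trans (sSup_le_sSup fun V hV => ⟨hV.1, i, hV.2⟩)
  exact this.2

end

end HypAux

/-- for a multiplicity-free `G`-algebra with no proper nontrivial
one-sided invariant ideals, both iterated hyperproducts `(X∘Y)∘Z` and `X∘(Y∘Z)` equal
the set of simple `G`-submodules of `X·Y·Z`; in particular `∘` is associative. -/
theorem hyperproduct_assoc_of_multiplicityFree
    {k A G : Type*} [Field k] [Ring A] [Algebra k A] [Group G]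
    [MulSemiringAction G A] [SMulCommClass G k A]
    (hmf : GMultiplicityFree k A G)
    (hleft : NoProperInvariantLeftIdeals k A G)
    (hright : NoProperInvariantRightIdeals k A G)
    (X Y Z : Submodule k A) (hX : IsSimpleGSubmodule G X) (hY : IsSimpleGSubmodule G Y)
    (hZ : IsSimpleGSubmodule G Z) :
    ({W | IsSimpleGSubmodule G W ∧ ∃ U, IsSimpleGSubmodule G U ∧ U ≤ X * Y ∧ W ≤ U * Z}
        = {W | IsSimpleGSubmodule G W ∧ W ≤ X * Y * Z}) ∧
    ({W | IsSimpleGSubmodule G W ∧ ∃ T, IsSimpleGSubmodule G T ∧ T ≤ Y * Z ∧ W ≤ X * T}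
        = {W | IsSimpleGSubmodule G W ∧ W ≤ X * Y * Z}) := by
  refine ⟨Set.ext fun W => ⟨?_, ?_⟩, Set.ext fun W => ⟨?_, ?_⟩⟩
  · rintro ⟨hW, U, -, hUle, hWle⟩
    exact ⟨hW, hWle.trans (mul_le_mul_left hUle Z)⟩
  · rintro ⟨hW, hle⟩
    have h := hle.trans (mul_le_mul_left (HypAux.eq_sSup hmf.1 (HypAux.mul_inv hX.1 hY.1)) Z)
    rw [sSup_eq_iSup', Submodule.iSup_mul] at h
    obtain ⟨U, hU⟩ := HypAux.key hmf hW _ (fun U => HypAux.mul_inv U.2.1.1 hZ.1) h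
    exact ⟨hW, U.1, U.2.1, U.2.2, hU⟩
  · rintro ⟨hW, T, -, hTle, hWle⟩
    rw [Set.mem_ofPred_eq, mul_assoc]
    exact ⟨hW, hWle.trans (mul_le_mul_right hTle X)⟩
  · rintro ⟨hW, hle⟩
    rw [mul_assoc] at hle
    have h := hle.trans (mul_le_mul_right (HypAux.eq_sSup hmf.1 (HypAux.mul_inv hY.1 hZ.1)) X)
    rw [sSup_eq_iSup', Submodule.mul_iSup] at h
    obtain ⟨T, hT⟩ := HypAux.key hmf hW _ (fun T => HypAux.mul_inv hX.1 T.2.1.1) h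
    exact ⟨hW, T.1, T.2.1, T.2.2, hT⟩
end

section
/- Let A be a multiplicity-free G-algebra having no invariant left ideals and no invariant right ideals other than 0 and A. Then: (a) for all simple G-submodules X, Y of A, the set X∘Y is nonempty; and (b) the reproductive law holds: for every simple G-submodule X and every simple G-submodule W of A, there exist simple G-submodules U and U' with W ⊆ U·X and W ⊆ X·U'. (Thus the simple G-submodules of A form a hypergroup under ∘.) -/
section Helpers
variable {k A G : Type*} [Field k] [Ring A] [Algebra k A] [Group G]
    [MulSemiringAction G A] [SMulCommClass G k A]

/-- The subalgebra of linear endomorphisms generated by the action. -/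
abbrev actAlg (k A G : Type*) [Field k] [Ring A] [Algebra k A] [Group G]
    [MulSemiringAction G A] [SMulCommClass G k A] : Subalgebra k (Module.End k A) :=
  Algebra.adjoin k (Set.range (fun g : G => DistribSMul.toLinearMap k A g))

/-- The same, as a bare type. -/
def ActAlg (k A G : Type*) [Field k] [Ring A] [Algebra k A] [Group G]
    [MulSemiringAction G A] [SMulCommClass G k A] := ↥(actAlg k A G)

instance : Ring (ActAlg k A G) := inferInstanceAs (Ring (actAlg k A G))

instance : Algebra k (ActAlg k A G) := inferInstanceAs (Algebra k (actAlg k A G))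

instance instModActAlg : @Module (ActAlg k A G) A _ (AddCommGroup.toAddCommMonoid) :=
  inferInstanceAs (Module (actAlg k A G) A)

instance : IsScalarTower k (ActAlg k A G) A := inferInstanceAs (IsScalarTower k (actAlg k A G) A)

/-- The element of `actAlg` given by a group element. -/
def actEl (k A : Type*) {G : Type*} [Field k] [Ring A] [Algebra k A] [Group G]
    [MulSemiringAction G A] [SMulCommClass G k A] (g : G) : ActAlg k A G :=
  ⟨DistribSMul.toLinearMap k A g, Algebra.subset_adjoin ⟨g, rfl⟩⟩

theorem actEl_smul (g : G) (a : A) : actEl k A g • a = g • a := rfl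

theorem actAlg_mem (E : Submodule k A) (h : IsGSubmodule G E) (r : ActAlg k A G) :
    ∀ a ∈ E, r • a ∈ E := by
  obtain ⟨r, hr⟩ := r
  change ∀ a ∈ E, r a ∈ E
  induction hr using Algebra.adjoin_induction with
  | mem x hx =>
    obtain ⟨g, rfl⟩ := hx
    exact fun a ha => h g a ha
  | algebraMap c => exact fun _ ha => E.smul_mem c ha
  | add x y _ _ hx hy => exact fun a ha => E.add_mem (hx a ha) (hy a ha)
  | mul x y _ _ hx hy => exact fun a ha => hx _ (hy a ha)

/-- A `G`-submodule as a submodule over `actAlg`. -/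
def toR (E : Submodule k A) (h : IsGSubmodule G E) : Submodule (ActAlg k A G) A :=
  { E.toAddSubmonoid with smul_mem' := fun r a ha => actAlg_mem E h r a ha }

theorem mem_toR (E : Submodule k A) (h : IsGSubmodule G E) (a : A) : a ∈ toR E h ↔ a ∈ E :=
  Iff.rfl

/-- Back to `k`-submodules. -/
def ofR (N : Submodule (ActAlg k A G) A) : Submodule k A := N.restrictScalars k

theorem mem_ofR (N : Submodule (ActAlg k A G) A) (a : A) : a ∈ ofR N ↔ a ∈ N := Iff.rfl

theorem ofR_inv (N : Submodule (ActAlg k A G) A) : IsGSubmodule G (ofR N) :=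
  fun g a ha => N.smul_mem (actEl k A g) ha

theorem atom_toR (X : Submodule k A) (h : IsSimpleGSubmodule G X) : IsAtom (toR X h.1) := by
  refine ⟨fun h0 => h.2.1 ?_, fun N hN => ?_⟩
  · ext a
    rw [← mem_toR X h.1, h0]; simp
  · rcases h.2.2 (ofR N) (ofR_inv N) (fun a ha => hN.le ha) with h1 | h1
    · ext a
      rw [← mem_ofR, h1]; simp
    · exfalso
      apply hN.ne
      ext a
      rw [← mem_ofR, h1]; rfl

theorem simple_ofR (N : Submodule (ActAlg k A G) A) (h : IsAtom N) :
    IsSimpleGSubmodule G (ofR N) := by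
  refine ⟨ofR_inv N, fun h0 => h.1 ?_, fun Y hY hle => ?_⟩
  · ext a
    rw [← mem_ofR, h0]; simp
  · have hle' : toR Y hY ≤ N := fun a ha => hle ha
    rcases h.le_iff.1 hle' with h1 | h1
    · left
      ext a
      rw [← mem_toR Y hY, h1]; simp
    · right
      ext a
      rw [← mem_toR Y hY, h1]; rfl

theorem semisimple_R (h : GSemisimple k A G) : IsSemisimpleModule (ActAlg k A G) A := by
  apply IsSemisimpleModule.of_sSup_simples_eq_top
  rw [eq_top_iff]
  have h1 : sSup {X : Submodule k A | IsSimpleGSubmodule G X} ≤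
      ofR (sSup {m : Submodule (ActAlg k A G) A | IsSimpleModule (ActAlg k A G) m}) := by
    apply sSup_le
    intro X hX a ha
    have : toR X hX.1 ≤ sSup {m : Submodule (ActAlg k A G) A | IsSimpleModule (ActAlg k A G) m} :=
      le_sSup (isSimpleModule_iff_isAtom.2 (atom_toR X hX))
    exact this ha
  intro a _
  have h2 : a ∈ sSup {X : Submodule k A | IsSimpleGSubmodule G X} := by
    have h' : sSup {X : Submodule k A | IsSimpleGSubmodule G X} = ⊤ := h
    rw [h']; trivial
  exact h1 h2

theorem le_of_simples (h : GSemisimple k A G) (E F : Submodule k A) (hE : IsGSubmodule G E)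
    (hF : IsGSubmodule G F)
    (H : ∀ Z : Submodule k A, IsSimpleGSubmodule G Z → Z ≤ E → Z ≤ F) : E ≤ F := by
  have := semisimple_R h
  have h1 : toR E hE ≤ toR F hF := by
    rw [← sSup_atoms_le_eq (toR E hE)]
    apply sSup_le
    rintro N ⟨hN, hle⟩
    exact H (ofR N) (simple_ofR N hN) hle
  exact h1

theorem exists_proj (h : GSemisimple k A G) (W : Submodule k A) (hW : IsGSubmodule G W) :
    ∃ p : A →ₗ[k] A, (∀ (g : G) (a : A), p (g • a) = g • p a) ∧ (∀ a, p a ∈ W) ∧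
      ∀ a ∈ W, p a = a := by
  have := semisimple_R h
  obtain ⟨f, hf⟩ := IsSemisimpleModule.extension_property (R := ActAlg k A G)
    (toR W hW).subtype (Submodule.subtype_injective _) LinearMap.id
  refine ⟨((toR W hW).subtype ∘ₗ f).restrictScalars k, fun g a => ?_, fun a => (f a).2,
    fun a ha => ?_⟩
  · exact map_smul ((toR W hW).subtype ∘ₗ f) (actEl k A g) a
  · have := LinearMap.congr_fun hf ⟨a, ha⟩
    exact congrArg Subtype.val this

theorem inv_mul (E F : Submodule k A) (hE : IsGSubmodule G E) (hF : IsGSubmodule G F) :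
    IsGSubmodule G (E * F) := by
  intro g
  have : E * F ≤ (E * F).comap (DistribSMul.toLinearMap k A g) := by
    rw [Submodule.mul_le]
    intro m hm n hn
    change g • (m * n) ∈ E * F
    rw [smul_mul']
    exact Submodule.mul_mem_mul (hE g m hm) (hF g n hn)
  exact this

theorem key (hmf : GMultiplicityFree k A G) {W : Submodule k A} (hW : IsSimpleGSubmodule G W)
    {ι : Sort*} (E : ι → Submodule k A) (hE : ∀ i, IsGSubmodule G (E i)) (htop : ⨆ i, E i = ⊤) :
    ∃ i, W ≤ E i := by
  obtain ⟨p, hp, hpW, hid⟩ := exists_proj hmf.1 W hW.1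
  have hker : IsGSubmodule G (LinearMap.ker p) := by
    intro g a ha
    rw [LinearMap.mem_ker] at ha ⊢
    rw [hp, ha, smul_zero]
  by_contra! hcon
  apply hW.2.1
  have hk : ⨆ i, E i ≤ LinearMap.ker p := by
    refine iSup_le fun i => le_of_simples hmf.1 _ _ (hE i) hker fun Z hZ hle => ?_
    by_contra hne
    have hdis : Z ⊓ LinearMap.ker p = ⊥ := by
      rcases hZ.2.2 (Z ⊓ LinearMap.ker p) (fun g a ha => ⟨hZ.1 g a ha.1, hker g a ha.2⟩)
        inf_le_left with h | h
      · exact h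
      · exact absurd (inf_eq_left.1 h) hne
    have hmap : Submodule.map p Z = W := by
      rcases hW.2.2 (Submodule.map p Z) (by
        rintro g _ ⟨z, hz, rfl⟩
        exact ⟨g • z, hZ.1 g z hz, hp g z⟩) (by
        rintro _ ⟨z, hz, rfl⟩
        exact hpW z) with h | h
      · exact absurd (LinearMap.le_ker_iff_map.2 h) hne
      · exact h
    have hZW := hmf.2 Z W hZ hW ⟨p, hp, hmap, disjoint_iff.2 hdis⟩
    exact hcon i (hZW ▸ hle)
  rw [htop] at hk
  rw [eq_bot_iff]
  intro w hw
  have h0 : p w = 0 := hk (Submodule.mem_top (x := w))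
  rw [hid w hw] at h0
  simpa using h0

end Helpers

/-- for a multiplicity-free `G`-algebra with no proper nontrivial
one-sided invariant ideals, the hyperproduct on simple `G`-submodules is nonempty and
satisfies the reproductive law (so the simple `G`-submodules form a hypergroup). -/
theorem hypergroup_of_multiplicityFree
    {k A G : Type*} [Field k] [Ring A] [Algebra k A] [Group G]
    [MulSemiringAction G A] [SMulCommClass G k A]
    (hmf : GMultiplicityFree k A G)
    (hleft : NoProperInvariantLeftIdeals k A G)
    (hright : NoProperInvariantRightIdeals k A G) :
    (∀ X Y : Submodule k A, IsSimpleGSubmodule G X → IsSimpleGSubmodule G Y →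
      ∃ Z, IsSimpleGSubmodule G Z ∧ Z ≤ X * Y) ∧
    (∀ X W : Submodule k A, IsSimpleGSubmodule G X → IsSimpleGSubmodule G W →
      ∃ U U', IsSimpleGSubmodule G U ∧ IsSimpleGSubmodule G U' ∧
        W ≤ U * X ∧ W ≤ X * U') := by
  have htop : IsGSubmodule G (⊤ : Submodule k A) := fun _ _ _ => trivial
  have hbot : IsGSubmodule G (⊥ : Submodule k A) := by
    intro g a ha
    rw [Submodule.mem_bot] at ha ⊢
    rw [ha, smul_zero]
  refine ⟨fun X Y hX hY => ?_, fun X W hX hW => ?_⟩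
  · by_contra! hcon
    have h0 : X * Y ≤ ⊥ := le_of_simples hmf.1 _ _ (inv_mul X Y hX.1 hY.1) hbot
      fun Z hZ hle => absurd hle (hcon Z hZ)
    let L : Submodule k A :=
      { carrier := {a | ∀ x ∈ X, x * a = 0}
        zero_mem' := fun x _ => mul_zero x
        add_mem' := fun {a b} ha hb x hx => by rw [mul_add, ha x hx, hb x hx, add_zero]
        smul_mem' := fun c a ha x hx => by rw [mul_smul_comm, ha x hx, smul_zero] }
    have hL : ∀ a, a ∈ L ↔ ∀ x ∈ X, x * a = 0 := fun a => Iff.rfl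
    have hYL : Y ≤ L := fun y hy x hx => by
      simpa using h0 (Submodule.mul_mem_mul hx hy)
    rcases hright L (fun a x hx y hy => by rw [← mul_assoc, hx y hy, zero_mul])
      (fun g a ha x hx => by
        have h1 := ha (g⁻¹ • x) (hX.1 _ x hx)
        have h2 := congrArg (fun t => g • t) h1
        simpa [smul_mul'] using h2) with h | h
    · exact hY.2.1 (le_bot_iff.1 (h ▸ hYL))
    · apply hX.2.1
      rw [eq_bot_iff]
      intro x hx
      have h1 : (1 : A) ∈ L := h ▸ Submodule.mem_top
      simpa using h1 x hx
  · have hss : ⨆ U : {X : Submodule k A | IsSimpleGSubmodule G X}, (U : Submodule k A) = ⊤ := by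
      rw [← sSup_eq_iSup']; exact hmf.1
    have hl : (⊤ : Submodule k A) * X = ⊤ := by
      rcases hleft (⊤ * X) (fun a x hx => by
        have h1 := Submodule.mul_mem_mul (Submodule.mem_top (R := k) (x := a)) hx
        rw [← mul_assoc] at h1
        exact (mul_le_mul' le_top le_rfl : (⊤ * ⊤ : Submodule k A) * X ≤ ⊤ * X) h1) (inv_mul _ _ htop hX.1) with h | h
      · exfalso
        apply hX.2.1
        rw [eq_bot_iff, ← h]
        intro x hx
        simpa using Submodule.mul_mem_mul (Submodule.mem_top (R := k) (x := (1 : A))) hx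
      · exact h
    have hr : X * (⊤ : Submodule k A) = ⊤ := by
      rcases hright (X * ⊤) (fun a x hx => by
        have h1 := Submodule.mul_mem_mul hx (Submodule.mem_top (R := k) (x := a))
        rw [mul_assoc] at h1
        exact (mul_le_mul' le_rfl le_top : X * (⊤ * ⊤ : Submodule k A) ≤ X * ⊤) h1) (inv_mul _ _ hX.1 htop) with h | h
      · exfalso
        apply hX.2.1
        rw [eq_bot_iff, ← h]
        intro x hx
        simpa using Submodule.mul_mem_mul hx (Submodule.mem_top (R := k) (x := (1 : A)))
      · exact h
    rw [← hss, Submodule.iSup_mul, hss] at hl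
    rw [← hss, Submodule.mul_iSup, hss] at hr
    obtain ⟨U, hU⟩ := key hmf hW _ (fun U => inv_mul _ _ U.2.1 hX.1) hl
    obtain ⟨U', hU'⟩ := key hmf hW _ (fun U => inv_mul _ _ hX.1 U.2.1) hr
    exact ⟨U, U', U.2, U'.2, hU, hU'⟩
end

section
/- Let R₀ be a ring and M a semisimple R₀-module that is multiplicity-free, i.e., no two distinct simple submodules of M are isomorphic as R₀-modules. If X is a simple submodule of M and (V_i)_{i∈I} is a family of submodules of M with X ≤ ∑_{i∈I} V_i, then there exists j ∈ I with X ≤ V_j. -/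
/-- if `M` is a semisimple `R₀`-module (a sum of simple submodules) that
is multiplicity-free (no two distinct simple submodules are isomorphic), then any
simple submodule lying below a sum of submodules lies below one of them.
Simple submodules are the atoms of the submodule lattice. -/
theorem simple_le_sum_of_multiplicityFree
    {R₀ M : Type*} [Ring R₀] [AddCommGroup M] [Module R₀ M]
    (hss : sSup {X : Submodule R₀ M | IsAtom X} = ⊤)
    (hmf : ∀ X Y : Submodule R₀ M, IsAtom X → IsAtom Y →
      Nonempty (X ≃ₗ[R₀] Y) → X = Y)
    {ι : Type*} (X : Submodule R₀ M) (hX : IsAtom X) (V : ι → Submodule R₀ M)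
    (h : X ≤ ⨆ i, V i) :
    ∃ j, X ≤ V j := by
  have : IsSemisimpleModule R₀ M := by
    apply IsSemisimpleModule.of_sSup_simples_eq_top
    rw [← hss]
    simp only [isSimpleModule_iff_isAtom]
  have : IsSimpleModule R₀ X := isSimpleModule_iff_isAtom.mpr hX
  rw [← sSup_range] at h
  obtain ⟨_, ⟨j, rfl⟩, S, hS, ⟨e⟩⟩ := X.le_linearEquiv_of_le_sSup _ h
  have : IsSimpleModule R₀ S := IsSimpleModule.congr e.symm
  exact ⟨j, (hmf X S hX (isSimpleModule_iff_isAtom.mp this) ⟨e⟩).le.trans hS⟩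
end

section
/- Let R be an atomistic subsemiring of S(A) (not assumed entire) such that for every atom X of R there exist atoms Y, Z of R with k·1_A ⊆ X·Y and k·1_A ⊆ Z·X. Then R is entire: E·F ≠ 0 for all nonzero E, F ∈ R. -/
/-!
Common setup: `A` is an associative unital algebra over a field `k`.  `S(A)` is the
complete lattice `Submodule k A` of `k`-subspaces, with the product `E * F` spanned
by products and multiplicative identity `1 = k·1_A`.
-/

variable {k A : Type*} [Field k] [Ring A] [Algebra k A]

/-- An atom of `R`: a minimal nonzero element of `R`. -/
def IsRAtom (R : Set (Submodule k A)) (X : Submodule k A) : Prop :=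
  X ∈ R ∧ X ≠ ⊥ ∧ ∀ Y ∈ R, Y ≤ X → Y = ⊥ ∨ Y = X

/-- An atomistic subsemiring of `S(A)`: contains `0` and `k·1_A`, closed under arbitrary
suprema, arbitrary (nonempty) infima and products of pairs, and every nonzero element is
the supremum of the atoms of `R` below it. -/
structure IsAtomisticSubsemiring (R : Set (Submodule k A)) : Prop where
  bot_mem : ⊥ ∈ R
  one_mem : (1 : Submodule k A) ∈ R
  sSup_mem : ∀ S : Set (Submodule k A), S ⊆ R → sSup S ∈ R
  sInf_mem : ∀ S : Set (Submodule k A), S ⊆ R → S.Nonempty → sInf S ∈ R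
  mul_mem : ∀ E ∈ R, ∀ F ∈ R, E * F ∈ R
  atomistic : ∀ E ∈ R, E ≠ ⊥ → E = sSup {X | IsRAtom R X ∧ X ≤ E}

/-- `R` is entire: no zero divisors. -/
def IsEntire (R : Set (Submodule k A)) : Prop :=
  ∀ E ∈ R, ∀ F ∈ R, E ≠ ⊥ → F ≠ ⊥ → E * F ≠ ⊥

/-- The relation ζ on atoms: `X ζ Y` iff both lie below a product of atoms of `R`. -/
def zeta (R : Set (Submodule k A)) (X Y : Submodule k A) : Prop :=
  ∃ L : List (Submodule k A), L ≠ [] ∧ (∀ Z ∈ L, IsRAtom R Z) ∧ X ≤ L.prod ∧ Y ≤ L.prod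

/-- ζ* is the transitive closure of ζ. -/
def zetaStar (R : Set (Submodule k A)) : Submodule k A → Submodule k A → Prop :=
  Relation.TransGen (zeta R)

/-- The focus of `R`: the atoms ζ*-related to `k·1_A`. -/
def focusSet (R : Set (Submodule k A)) : Set (Submodule k A) :=
  {X | IsRAtom R X ∧ zetaStar R X 1}

/-- The focal subalgebra of `R`: the supremum of the focus. -/
def focalSub (R : Set (Submodule k A)) : Submodule k A :=
  sSup (focusSet R)

/-- `R` is weakly reproducible. -/
def WeaklyReproducible (R : Set (Submodule k A)) : Prop :=
  ∀ X, IsRAtom R X → ∃ Y Z, IsRAtom R Y ∧ IsRAtom R Z ∧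
    (1 : Submodule k A) ≤ X * Y ∧ (1 : Submodule k A) ≤ Z * X

/-- `R` is reproducible. -/
def Reproducible (R : Set (Submodule k A)) : Prop :=
  ∀ X W, IsRAtom R X → IsRAtom R W → ∃ Y Z, IsRAtom R Y ∧ IsRAtom R Z ∧
    W ≤ X * Y ∧ W ≤ Z * X

/-- `R` has finite length: every chain in `R` is finite. -/
def ChainsFinite (R : Set (Submodule k A)) : Prop :=
  ∀ C ⊆ R, IsChain (· ≤ ·) C → C.Finite

/-- A complete subset of the atoms of `R`. -/
def IsCompleteSubset (R : Set (Submodule k A)) (E : Set (Submodule k A)) : Prop :=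
  ∀ X ∈ E, ∀ L : List (Submodule k A), L ≠ [] → (∀ Z ∈ L, IsRAtom R Z) →
    X ≤ L.prod → ∀ Y, IsRAtom R Y → Y ≤ L.prod → Y ∈ E

/-- a weakly reproducible atomistic subsemiring is automatically entire. -/
theorem entire_of_weak_reproductive_law
    (R : Set (Submodule k A)) (hR : IsAtomisticSubsemiring R)
    (h : ∀ X, IsRAtom R X → ∃ Y Z, IsRAtom R Y ∧ IsRAtom R Z ∧
      (1 : Submodule k A) ≤ X * Y ∧ (1 : Submodule k A) ≤ Z * X) :
    IsEntire R := by
  intro E hE F hF hE0 hF0 hEF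
  obtain ⟨X, hX, hXE⟩ : ∃ X, IsRAtom R X ∧ X ≤ E := by
    by_contra hne
    apply hE0
    rw [hR.atomistic E hE hE0, sSup_eq_bot]
    intro X hX
    exact absurd ⟨X, hX⟩ hne
  obtain ⟨Y, Z, hY, hZ, h1, h2⟩ := h X hX
  apply hF0
  rw [eq_bot_iff]
  calc F = 1 * F := (one_mul F).symm
    _ ≤ (Z * X) * F := mul_le_mul' h2 le_rfl
    _ ≤ (Z * E) * F := mul_le_mul' (mul_le_mul' le_rfl hXE) le_rfl
    _ = Z * (E * F) := mul_assoc _ _ _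
    _ = ⊥ := by rw [hEF, Submodule.mul_bot]
    _ ≤ ⊥ := le_rfl
end

section
/- Let R be an entire atomistic subsemiring of S(A) that is reproducible. Then the relation ζ on the atoms of R is transitive (hence ζ = ζ*). -/
/-!
Common setup: `A` is an associative unital algebra over a field `k`.  `S(A)` is the
complete lattice `Submodule k A` of `k`-subspaces, with the product `E * F` spanned
by products and multiplicative identity `1 = k·1_A`.
-/

variable {k A : Type*} [Field k] [Ring A] [Algebra k A]

/-- for `R` reproducible, the relation ζ on atoms is transitive. -/
theorem zeta_transitive_of_reproducible
    (R : Set (Submodule k A)) (hR : IsAtomisticSubsemiring R) (hEnt : IsEntire R)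
    (hrep : Reproducible R) (X Y Z : Submodule k A)
    (hX : IsRAtom R X) (hY : IsRAtom R Y) (hZ : IsRAtom R Z)
    (h1 : zeta R X Y) (h2 : zeta R Y Z) :
    zeta R X Z := by
  have hne : (1 : A) ≠ 0 := by
    intro h
    apply hY.2.1
    rw [Submodule.eq_bot_iff]
    intro x _
    rw [← mul_one x, h, mul_zero]
  have h1at : IsAtom (1 : Submodule k A) := by
    rw [Submodule.one_eq_span]
    exact nonzero_span_atom (1 : A) hne
  have hone : IsRAtom R (1 : Submodule k A) :=
    ⟨hR.one_mem, h1at.1, fun W _ hW => h1at.le_iff.1 hW⟩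
  obtain ⟨V, U, hV, hU, hYV, hUY⟩ := hrep Y 1 hY hone
  obtain ⟨L, hL, hLa, hXL, hYL⟩ := h1
  obtain ⟨M, hM, hMa, hYM, hZM⟩ := h2
  have hUM : U ≤ U * (Y * V) := by
    calc U = U * 1 := (mul_one U).symm
      _ ≤ _ := mul_le_mul' le_rfl hYV
  have hVM : V ≤ U * (Y * V) := by
    calc V = 1 * V := (one_mul V).symm
      _ ≤ (U * Y) * V := mul_le_mul' hUY le_rfl
      _ = _ := mul_assoc _ _ _
  have hprod : (L ++ ([U, Y, V] ++ M)).prod = L.prod * ((U * (Y * V)) * M.prod) := by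
    simp [mul_assoc]
  refine ⟨L ++ ([U, Y, V] ++ M), by simp, ?_, ?_, ?_⟩
  · intro W hW
    simp only [List.mem_append, List.mem_cons, List.not_mem_nil, or_false] at hW
    rcases hW with h | (rfl | rfl | rfl) | h
    · exact hLa _ h
    · exact hU
    · exact hY
    · exact hV
    · exact hMa _ h
  · rw [hprod]
    calc X = X * 1 := (mul_one X).symm
      _ ≤ X * (U * Y) := mul_le_mul' le_rfl hUY
      _ ≤ _ := mul_le_mul' hXL (mul_le_mul' hUM hYM)
  · rw [hprod, ← mul_assoc]
    calc Z = 1 * Z := (one_mul Z).symm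
      _ ≤ (Y * V) * Z := mul_le_mul' hYV le_rfl
      _ ≤ _ := mul_le_mul' (mul_le_mul' hYL hVM) hZM
end

section
/- Let A be a G-algebra that is semisimple as a k[G]-module and in which the subspace of G-fixed points equals k·1_A (the trivial representation has multiplicity one). Then A has no invariant left ideals and no invariant right ideals other than 0 and A if and only if for every simple G-submodule X of A there exist simple G-submodules Y, Z of A with k·1_A ⊆ X·Y and k·1_A ⊆ Z·X (i.e., the subrepresentation semiring S_G(A) is weakly reproducible). -/
section helpers
variable {k A G : Type*} [Field k] [Ring A] [Algebra k A] [Group G]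
    [MulSemiringAction G A]

theorem gs_inf {E F : Submodule k A} (hE : IsGSubmodule G E) (hF : IsGSubmodule G F) :
    IsGSubmodule G (E ⊓ F) := fun g a ha => ⟨hE g a ha.1, hF g a ha.2⟩

theorem gs_sSup [SMulCommClass G k A] {S : Set (Submodule k A)}
    (h : ∀ E ∈ S, IsGSubmodule G E) : IsGSubmodule G (sSup S) := by
  intro g
  change sSup S ≤ (sSup S).comap (DistribSMul.toLinearMap k A g)
  refine sSup_le fun E hE a ha => ?_
  exact (le_sSup hE : E ≤ sSup S) (h E hE g a ha)

theorem gs_sup [SMulCommClass G k A] {E F : Submodule k A} (hE : IsGSubmodule G E)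
    (hF : IsGSubmodule G F) : IsGSubmodule G (E ⊔ F) := by
  rw [← sSup_pair]
  apply gs_sSup
  rintro X (rfl | rfl) <;> assumption

theorem gs_mul [SMulCommClass G k A] {E F : Submodule k A} (hE : IsGSubmodule G E)
    (hF : IsGSubmodule G F) : IsGSubmodule G (E * F) := by
  intro g
  change E * F ≤ (E * F).comap (DistribSMul.toLinearMap k A g)
  rw [Submodule.mul_le]
  intro m hm n hn
  change g • (m * n) ∈ E * F
  rw [smul_mul']
  exact Submodule.mul_mem_mul (hE g m hm) (hF g n hn)

theorem exists_not_le (hss : GSemisimple k A G) {E : Submodule k A} (hE : E ≠ ⊤) :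
    ∃ X, IsSimpleGSubmodule G X ∧ ¬ X ≤ E := by
  by_contra! h
  apply hE
  rw [eq_top_iff, ← hss]
  exact sSup_le h

theorem exists_gcompl [SMulCommClass G k A] (hss : GSemisimple k A G) {E : Submodule k A}
    (hE : IsGSubmodule G E) : ∃ C, IsGSubmodule G C ∧ Disjoint E C ∧ E ⊔ C = ⊤ := by
  obtain ⟨C, hC⟩ := zorn_le₀ {C : Submodule k A | IsGSubmodule G C ∧ Disjoint E C} (by
    intro c hc hch
    refine ⟨sSup c, ⟨gs_sSup fun X hX => (hc hX).1, ?_⟩, fun z hz => le_sSup hz⟩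
    rw [DirectedOn.disjoint_sSup_right hch.directedOn]
    exact fun X hX => (hc hX).2)
  refine ⟨C, hC.prop.1, hC.prop.2, ?_⟩
  by_contra hne
  obtain ⟨X, hX, hXn⟩ := exists_not_le hss hne
  have hd : Disjoint (E ⊔ C) X := by
    rcases hX.2.2 ((E ⊔ C) ⊓ X) (gs_inf (gs_sup hE hC.prop.1) hX.1) inf_le_right with h | h
    · exact disjoint_iff.2 h
    · exact absurd (inf_eq_right.1 h) hXn
  have := hC.le_of_ge (y := C ⊔ X) ⟨gs_sup hC.prop.1 hX.1,
    hC.prop.2.disjoint_sup_right_of_disjoint_sup_left hd⟩ le_sup_left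
  exact hXn ((le_sup_right.trans this).trans le_sup_right)

theorem exists_simple_le [SMulCommClass G k A] (hss : GSemisimple k A G) {L : Submodule k A}
    (hL : IsGSubmodule G L) (h0 : L ≠ ⊥) : ∃ X, IsSimpleGSubmodule G X ∧ X ≤ L := by
  obtain ⟨D, hD, hdis, htop⟩ := exists_gcompl hss hL
  have hDt : D ≠ ⊤ := by
    rintro rfl
    exact h0 (by simpa using hdis)
  obtain ⟨S, hS, hSD⟩ := exists_not_le hss hDt
  refine ⟨(D ⊔ S) ⊓ L, ⟨gs_inf (gs_sup hD hS.1) hL, ?_, ?_⟩, inf_le_right⟩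
  · intro h
    have h1 : D ⊔ L ⊓ (D ⊔ S) = (D ⊔ L) ⊓ (D ⊔ S) := (sup_inf_assoc_of_le L le_sup_left).symm
    rw [inf_comm L, h, sup_comm D L, htop, top_inf_eq, sup_bot_eq] at h1
    exact hSD (h1 ▸ le_sup_right)
  · intro Y hY hYX
    have hYL := hYX.trans inf_le_right
    have hYS := hYX.trans inf_le_left
    rcases hS.2.2 ((D ⊔ Y) ⊓ S) (gs_inf (gs_sup hD hY) hS.1) inf_le_right with h | h
    · left
      have h1 : D ⊔ S ⊓ (D ⊔ Y) = (D ⊔ S) ⊓ (D ⊔ Y) := (sup_inf_assoc_of_le S le_sup_left).symm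
      rw [inf_comm S, h, sup_bot_eq, inf_eq_right.2 (sup_le le_sup_left hYS)] at h1
      have : Y ≤ D := h1 ▸ le_sup_right
      exact le_bot_iff.1 (hdis hYL this)
    · right
      refine le_antisymm hYX ?_
      have h1 : Y ⊔ D ⊓ L = (Y ⊔ D) ⊓ L := (sup_inf_assoc_of_le D hYL).symm
      rw [inf_comm D, hdis.eq_bot, sup_bot_eq] at h1
      conv_rhs => rw [h1]
      exact inf_le_inf_right _ (sup_le le_sup_right
        ((inf_eq_right.1 h).trans (sup_comm D Y).le))

theorem one_le_of_not_le [SMulCommClass G k A] (hss : GSemisimple k A G)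
    (hfix : {a : A | ∀ g : G, g • a = a} = ((1 : Submodule k A) : Set A))
    {C E : Submodule k A} (hC : IsGSubmodule G C) (htop : 1 ⊔ C = ⊤)
    (hE : IsGSubmodule G E) (hEC : ¬ E ≤ C) : (1 : Submodule k A) ≤ E := by
  obtain ⟨D, hD, hdis, hDt⟩ := exists_gcompl hss (gs_inf hE hC)
  have hne : E ⊓ D ≠ ⊥ := by
    intro h
    have h1 : (E ⊓ C) ⊔ D ⊓ E = ((E ⊓ C) ⊔ D) ⊓ E := (sup_inf_assoc_of_le D inf_le_left).symm
    rw [hDt, top_inf_eq, inf_comm D, h, sup_bot_eq] at h1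
    exact hEC (inf_eq_left.1 h1)
  obtain ⟨d, hd, hd0⟩ := Submodule.exists_mem_ne_zero_of_ne_bot hne
  have hdt : d ∈ 1 ⊔ C := htop ▸ Submodule.mem_top
  obtain ⟨u, hu, c, hc, rfl⟩ := Submodule.mem_sup.1 hdt
  have hu' : ∀ g : G, g • u = u := by
    have : u ∈ {a : A | ∀ g : G, g • a = a} := hfix ▸ hu
    exact this
  have hdfix : u + c ∈ {a : A | ∀ g : G, g • a = a} := by
    intro g
    rw [← sub_eq_zero]
    have h1 : g • (u + c) - (u + c) ∈ C := by
      rw [smul_add, hu' g, add_sub_add_left_eq_sub]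
      exact C.sub_mem (hC g c hc) hc
    have h2 : g • (u + c) - (u + c) ∈ E ⊓ D := (E ⊓ D).sub_mem (gs_inf hE hD g _ hd) hd
    have := Submodule.disjoint_def.1 hdis _ ⟨h2.1, h1⟩ h2.2
    exact this
  rw [hfix] at hdfix
  obtain ⟨r, hr⟩ := Submodule.mem_one.1 hdfix
  have hr0 : r ≠ 0 := by
    rintro rfl
    exact hd0 (by rw [← hr, map_zero])
  rw [Submodule.one_le]
  have : r⁻¹ • (u + c) = 1 := by
    rw [← hr, Algebra.algebraMap_eq_smul_one, smul_smul, inv_mul_cancel₀ hr0, one_smul]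
  rw [← this]
  exact E.smul_mem _ hd.1

end helpers

/-- for a semisimple `G`-algebra whose `G`-fixed points are exactly
`k·1_A`, having no proper nontrivial one-sided invariant ideals is equivalent to weak
reproducibility of the subrepresentation semiring. -/
theorem no_invariant_ideals_iff_weakly_reproducible
    {k A G : Type*} [Field k] [Ring A] [Algebra k A] [Group G]
    [MulSemiringAction G A] [SMulCommClass G k A]
    (hss : GSemisimple k A G)
    (hfix : {a : A | ∀ g : G, g • a = a} = ((1 : Submodule k A) : Set A)) :
    (NoProperInvariantLeftIdeals k A G ∧ NoProperInvariantRightIdeals k A G) ↔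
      (∀ X : Submodule k A, IsSimpleGSubmodule G X →
        ∃ Y Z : Submodule k A, IsSimpleGSubmodule G Y ∧ IsSimpleGSubmodule G Z ∧
          (1 : Submodule k A) ≤ X * Y ∧ (1 : Submodule k A) ≤ Z * X) := by
  have htopG : IsGSubmodule G (⊤ : Submodule k A) := fun _ _ _ => Submodule.mem_top
  have honeG : IsGSubmodule G (1 : Submodule k A) := by
    intro g a ha
    have : a ∈ {a : A | ∀ g : G, g • a = a} := hfix ▸ ha
    rw [this g]
    exact ha
  constructor
  · rintro ⟨hl, hr⟩ X hX
    obtain ⟨C, hC, hdis, htop⟩ := exists_gcompl hss honeG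
    have hXl : X ≤ ⊤ * X := fun x hx => by
      simpa using Submodule.mul_mem_mul (Submodule.mem_top : (1 : A) ∈ (⊤ : Submodule k A)) hx
    have hXr : X ≤ X * ⊤ := fun x hx => by
      simpa using Submodule.mul_mem_mul hx (Submodule.mem_top : (1 : A) ∈ (⊤ : Submodule k A))
    have hCt : C ≠ ⊤ := by
      rintro rfl
      have h1 : (1 : Submodule k A) = ⊥ := by simpa using hdis
      have h2 : X = ⊥ := by rw [← one_mul X, h1, Submodule.bot_mul]
      exact hX.2.1 h2
    have hl' : ⊤ * X = ⊤ := by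
      refine (hl (⊤ * X) ?_ (gs_mul htopG hX.1)).resolve_left
        fun h => hX.2.1 (le_bot_iff.1 (h ▸ hXl))
      intro a x hx
      have h3 : (⊤ : Submodule k A) * (⊤ * X) ≤ ⊤ * X := by
        rw [← mul_assoc]
        exact mul_le_mul' le_top le_rfl
      exact h3 (Submodule.mul_mem_mul Submodule.mem_top hx)
    have hr' : X * ⊤ = ⊤ := by
      refine (hr (X * ⊤) ?_ (gs_mul hX.1 htopG)).resolve_left
        fun h => hX.2.1 (le_bot_iff.1 (h ▸ hXr))
      intro a x hx
      have h3 : X * ⊤ * (⊤ : Submodule k A) ≤ X * ⊤ := by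
        rw [mul_assoc]
        exact mul_le_mul' le_rfl le_top
      exact h3 (Submodule.mul_mem_mul hx Submodule.mem_top)
    have hY : ∃ Y, IsSimpleGSubmodule G Y ∧ ¬ X * Y ≤ C := by
      by_contra! h
      apply hCt
      rw [eq_top_iff, ← hr', Submodule.mul_le]
      intro x hx y _
      have h4 : (⊤ : Submodule k A) ≤ C.comap (LinearMap.mulLeft k x) := by
        rw [← hss]
        exact sSup_le fun Y hY y hy => h Y hY (Submodule.mul_mem_mul hx hy)
      exact h4 (Submodule.mem_top : y ∈ _)
    have hZ : ∃ Z, IsSimpleGSubmodule G Z ∧ ¬ Z * X ≤ C := by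
      by_contra! h
      apply hCt
      rw [eq_top_iff, ← hl', Submodule.mul_le]
      intro y _ x hx
      have h4 : (⊤ : Submodule k A) ≤ C.comap (LinearMap.mulRight k x) := by
        rw [← hss]
        exact sSup_le fun Y hY y hy => h Y hY (Submodule.mul_mem_mul hy hx)
      exact h4 (Submodule.mem_top : y ∈ _)
    obtain ⟨Y, hY, hYC⟩ := hY
    obtain ⟨Z, hZ, hZC⟩ := hZ
    exact ⟨Y, Z, hY, hZ, one_le_of_not_le hss hfix hC htop (gs_mul hX.1 hY.1) hYC,
      one_le_of_not_le hss hfix hC htop (gs_mul hZ.1 hX.1) hZC⟩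
  · intro H
    constructor
    · intro L hL hLG
      refine or_iff_not_imp_left.2 fun h0 => ?_
      obtain ⟨X, hX, hXL⟩ := exists_simple_le hss hLG h0
      obtain ⟨Y, Z, -, -, -, h1⟩ := H X hX
      have h2 : Z * X ≤ L := Submodule.mul_le.2 fun z _ x hx => hL z x (hXL hx)
      have h3 : (1 : A) ∈ L := Submodule.one_le.1 (h1.trans h2)
      exact eq_top_iff.2 fun a _ => by simpa using hL a 1 h3
    · intro L hL hLG
      refine or_iff_not_imp_left.2 fun h0 => ?_
      obtain ⟨X, hX, hXL⟩ := exists_simple_le hss hLG h0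
      obtain ⟨Y, Z, -, -, h1, -⟩ := H X hX
      have h2 : X * Y ≤ L := Submodule.mul_le.2 fun x hx z _ => hL z x (hXL hx)
      have h3 : (1 : A) ∈ L := Submodule.one_le.1 (h1.trans h2)
      exact eq_top_iff.2 fun a _ => by simpa using hL a 1 h3
end
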